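/- arXiv:1404.5741 — 2 statements merged into one kernel-verified Lean document; each statement's English description precedes it below -/
import Mathlib

section
/- Let A, Ā, B ∈ ℝ with 2A + Ā ≠ 0, let T > 0, x̄₀ ∈ ℝ, and let φ : [0,T] → ℝ be differentiable with φ'(t) = (A + Ā)φ(t) − B²φ(T)e^{A(T−t)} for all t ∈ [0,T] and φ(0) = x̄₀. Then e^{−(A + Ā)T}φ(T) − x̄₀ = −B²φ(T)e^{AT} · (1 − e^{−(2A + Ā)T})/(2A + Ā). -/
noncomputable section

/-- Section 6: if `φ` solves the scalar linear ODE
`φ'(t) = (A + Ā)φ(t) − B²φ(T)e^{A(T−t)}` on `[0,T]` with `φ(0) = x̄₀` and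
`2A + Ā ≠ 0`, then
`e^{−(A+Ā)T}φ(T) − x̄₀ = −B²φ(T)e^{AT}(1 − e^{−(2A+Ā)T})/(2A+Ā)`. -/
theorem scalar_terminal_coupled_ode_solution
    (T : ℝ) (hT : 0 < T) (A Abar B x₀ : ℝ) (hne : 2 * A + Abar ≠ 0)
    (φ : ℝ → ℝ)
    (hφ : ∀ t ∈ Set.Icc (0:ℝ) T,
      HasDerivWithinAt φ
        ((A + Abar) * φ t - B^2 * φ T * Real.exp (A * (T - t)))
        (Set.Icc (0:ℝ) T) t)
    (hφ0 : φ 0 = x₀) :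
    Real.exp (-(A + Abar) * T) * φ T - x₀
      = -(B^2) * φ T * Real.exp (A * T)
        * ((1 - Real.exp (-(2 * A + Abar) * T)) / (2 * A + Abar)) := by
  set k := 2 * A + Abar with hk
  have hderiv : ∀ t ∈ Set.Icc (0:ℝ) T,
      HasDerivWithinAt
        (fun s => Real.exp (-(A + Abar) * s) * φ s
          - B^2 * φ T * Real.exp (A * T) * (Real.exp (-k * s) / k))
        0 (Set.Icc (0:ℝ) T) t := by
    intro t ht
    have h_exp (c : ℝ) : HasDerivWithinAt (fun s => Real.exp (c * s))
        (Real.exp (c * t) * (c * 1)) (Set.Icc (0:ℝ) T) t :=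
      ((hasDerivAt_id t).const_mul c).exp.hasDerivWithinAt
    refine (((h_exp (-(A + Abar))).mul (hφ t ht)).sub
      (((h_exp (-k)).div_const k).const_mul (B^2 * φ T * Real.exp (A * T)))).congr_deriv ?_
    have hadd : Real.exp (-(A + Abar) * t) * Real.exp (A * (T - t))
        = Real.exp (A * T) * Real.exp (-k * t) := by
      rw [← Real.exp_add, ← Real.exp_add, hk]
      ring_nf
    have hdiv : Real.exp (-k * t) * (-k * 1) / k = -Real.exp (-k * t) := by
      field_simp
    rw [hdiv]
    linear_combination (-(B^2) * φ T) * hadd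
  have hconst := constant_of_has_deriv_right_zero
    (fun t ht => (hderiv t ht).continuousWithinAt)
    (fun t ht => (hderiv t (Set.Ico_subset_Icc_self ht)).mono_of_mem_nhdsWithin
      (Icc_mem_nhdsGE_of_mem ht))
    T (Set.right_mem_Icc.mpr hT.le)
  simp only [mul_zero, Real.exp_zero, one_mul, hφ0] at hconst
  linear_combination hconst

end
end

section
/- Let a, α, γ, r, b be real numbers with b ≠ 0, r > 0 and γ ≤ 1. Then the quadratic equation −(b²/r)ς² + (2a + α)ς + (1 − γ) = 0 has two real roots ς₁ ≥ 0 and ς₂ ≤ 0. Assume moreover ς₁ > ς₂. Then for every T > 0 the function P(t) = ((1 − γ)r/b²) · (exp((ς₁ − ς₂)(b²/r)(T − t)) − 1)/(ς₁ − ς₂ exp((ς₁ − ς₂)(b²/r)(T − t))) is well-defined on [0,T] (its denominator never vanishes) and satisfies P'(t) = −(2a + α)P(t) + (b²/r)P(t)² − 1 + γ on [0,T] with P(T) = 0. -/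
noncomputable section

/-- A quadratic `-k x² + m x + q` with `k > 0` and `q ≥ 0` has a nonnegative and a nonpositive
root. -/
theorem exists_nonneg_nonpos_roots {k m q : ℝ} (hk : 0 < k) (hq : 0 ≤ q) :
    ∃ x y : ℝ, 0 ≤ x ∧ y ≤ 0 ∧ -k * x ^ 2 + m * x + q = 0 ∧ -k * y ^ 2 + m * y + q = 0 := by
  have hsq : √(m ^ 2 + 4 * k * q) ^ 2 = m ^ 2 + 4 * k * q := Real.sq_sqrt (by positivity)
  have habs : |m| ≤ √(m ^ 2 + 4 * k * q) :=
    Real.abs_le_sqrt (le_add_of_nonneg_right (by positivity))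
  generalize √(m ^ 2 + 4 * k * q) = s at hsq habs
  obtain ⟨hneg, hpos⟩ := abs_le.mp habs
  refine ⟨(m + s) / (2 * k), (m - s) / (2 * k),
    div_nonneg (by linarith) (by positivity),
    div_nonpos_of_nonpos_of_nonneg (by linarith) (by positivity), ?_, ?_⟩
  all_goals
    field_simp
    linear_combination -hsq

/-- Vieta's formulas for two distinct real roots of `-k x² + m x + q`. -/
theorem vieta_of_distinct_roots {k m q x y : ℝ} (hx : -k * x ^ 2 + m * x + q = 0)
    (hy : -k * y ^ 2 + m * y + q = 0) (hxy : x ≠ y) :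
    m = k * (x + y) ∧ q = -(k * (x * y)) := by
  have hm : m = k * (x + y) :=
    mul_left_cancel₀ (sub_ne_zero.mpr hxy) (by linear_combination hx - hy)
  exact ⟨hm, by linear_combination hx - x * hm⟩

theorem sub_mul_exp_pos {x y : ℝ} (hx : 0 ≤ x) (hy : y ≤ 0) (hyx : y < x) (u : ℝ) :
    0 < x - y * Real.exp u := by
  rcases hy.lt_or_eq with hy | rfl
  · linarith [mul_neg_of_neg_of_pos hy (Real.exp_pos u)]
  · simpa using hyx

/-- The explicit solution of the scalar Riccati equation `P' = k (P - x) (P - y)` with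
`P T = 0`. -/
theorem hasDerivAt_riccati_solution {k x y T t : ℝ}
    (hD : x - y * Real.exp ((x - y) * k * (T - t)) ≠ 0) :
    HasDerivAt
      (fun t => -(x * y) * (Real.exp ((x - y) * k * (T - t)) - 1)
        / (x - y * Real.exp ((x - y) * k * (T - t))))
      (k * (-(x * y) * (Real.exp ((x - y) * k * (T - t)) - 1)
          / (x - y * Real.exp ((x - y) * k * (T - t))) - x)
        * (-(x * y) * (Real.exp ((x - y) * k * (T - t)) - 1)
          / (x - y * Real.exp ((x - y) * k * (T - t))) - y)) t := by
  have hE : HasDerivAt (fun t => Real.exp ((x - y) * k * (T - t)))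
      (Real.exp ((x - y) * k * (T - t)) * ((x - y) * k * -1)) t :=
    (((hasDerivAt_id t).const_sub T).const_mul ((x - y) * k)).exp
  refine (((hE.sub_const 1).const_mul (-(x * y))).fun_div
    ((hE.const_mul y).const_sub x) hD).congr_deriv ?_
  field_simp
  ring

/-- Appendix, BSYY approach: under `γ ≤ 1` the quadratic
`−(b²/r)ς² + (2a + α)ς + (1 − γ) = 0` has two real roots `ς₁ ≥ 0`, `ς₂ ≤ 0`;
moreover, for any such roots with `ς₁ > ς₂` and any horizon `T > 0`, the function
`P(t) = ((1 − γ)r/b²)(e^{(ς₁−ς₂)(b²/r)(T−t)} − 1)/(ς₁ − ς₂e^{(ς₁−ς₂)(b²/r)(T−t)})`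
has nonvanishing denominator on `[0,T]` and solves
`P' = −(2a + α)P + (b²/r)P² − 1 + γ`, `P(T) = 0`. -/
theorem appendix_nonsymmetric_riccati
    (a α γ r b : ℝ) (hb : b ≠ 0) (hr : 0 < r) (hγ : γ ≤ 1) :
    (∃ ς₁ ς₂ : ℝ, 0 ≤ ς₁ ∧ ς₂ ≤ 0 ∧
        -(b^2 / r) * ς₁^2 + (2 * a + α) * ς₁ + (1 - γ) = 0 ∧
        -(b^2 / r) * ς₂^2 + (2 * a + α) * ς₂ + (1 - γ) = 0) ∧
    (∀ ς₁ ς₂ : ℝ, 0 ≤ ς₁ → ς₂ ≤ 0 →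
        -(b^2 / r) * ς₁^2 + (2 * a + α) * ς₁ + (1 - γ) = 0 →
        -(b^2 / r) * ς₂^2 + (2 * a + α) * ς₂ + (1 - γ) = 0 →
        ς₂ < ς₁ →
        ∀ T : ℝ, 0 < T →
          (∀ t ∈ Set.Icc (0:ℝ) T,
            ς₁ - ς₂ * Real.exp ((ς₁ - ς₂) * (b^2 / r) * (T - t)) ≠ 0) ∧
          (∀ t ∈ Set.Icc (0:ℝ) T,
            HasDerivWithinAt
              (fun t => ((1 - γ) * r / b^2)
                * (Real.exp ((ς₁ - ς₂) * (b^2 / r) * (T - t)) - 1)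
                / (ς₁ - ς₂ * Real.exp ((ς₁ - ς₂) * (b^2 / r) * (T - t))))
              (-(2 * a + α)
                  * (((1 - γ) * r / b^2)
                    * (Real.exp ((ς₁ - ς₂) * (b^2 / r) * (T - t)) - 1)
                    / (ς₁ - ς₂ * Real.exp ((ς₁ - ς₂) * (b^2 / r) * (T - t))))
                + (b^2 / r)
                  * (((1 - γ) * r / b^2)
                    * (Real.exp ((ς₁ - ς₂) * (b^2 / r) * (T - t)) - 1)
                    / (ς₁ - ς₂ * Real.exp ((ς₁ - ς₂) * (b^2 / r) * (T - t))))^2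
                - 1 + γ)
              (Set.Icc (0:ℝ) T) t) ∧
          ((1 - γ) * r / b^2)
              * (Real.exp ((ς₁ - ς₂) * (b^2 / r) * (T - T)) - 1)
              / (ς₁ - ς₂ * Real.exp ((ς₁ - ς₂) * (b^2 / r) * (T - T))) = 0) := by
  have hk : 0 < b ^ 2 / r := by positivity
  refine ⟨exists_nonneg_nonpos_roots hk (sub_nonneg.mpr hγ), ?_⟩
  intro x y hx hy hqx hqy hyx T _
  have hD (t : ℝ) : x - y * Real.exp ((x - y) * (b ^ 2 / r) * (T - t)) ≠ 0 :=
    (sub_mul_exp_pos hx hy hyx _).ne'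
  obtain ⟨hm, hq⟩ := vieta_of_distinct_roots hqx hqy hyx.ne'
  have hc : (1 - γ) * r / b ^ 2 = -(x * y) := by
    rw [hq]
    field_simp
  refine ⟨fun t _ => hD t, fun t _ => ?_, by simp⟩
  rw [hc]
  refine ((hasDerivAt_riccati_solution (hD t)).congr_deriv ?_).hasDerivWithinAt
  rw [hm]
  linear_combination hq

end
end
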